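/- Let Ψ be an Orlicz function whose complementary function Φ satisfies the Δ₂ condition (i.e., Ψ ∈ ∇₂), (Ω,P) a probability space, X a closed linear subspace of the Morse–Transue space M^Ψ, Y a Banach space, and T : X → Y a bounded linear operator. Then T is weakly compact if and only if: for every ε > 0 there exists C_ε > 0 such that ‖Tf‖ ≤ [C_ε ∫_Ω Ψ(ε |f| / ‖f‖_Ψ) dP + ε] · ‖f‖_Ψ for every nonzero f ∈ X. -/

import Mathlib

open MeasureTheory Filter Set Topology ENNReal NNReal

noncomputable section

/-- An Orlicz function: non-decreasing, convex (indeed strictly convex), vanishing and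
continuous at `0`, with `Ψ x / x → ∞` as `x → ∞`. (We regard it as a function `ℝ → ℝ`,
only its values on `[0,∞)` being relevant.) -/
structure IsOrliczFunction (Ψ : ℝ → ℝ) : Prop where
  map_zero : Ψ 0 = 0
  nonneg : ∀ x, 0 ≤ Ψ x
  mono : MonotoneOn Ψ (Set.Ici (0 : ℝ))
  strictConvexOn : StrictConvexOn ℝ (Set.Ici (0 : ℝ)) Ψ
  continuousWithinAt_zero : ContinuousWithinAt Ψ (Set.Ici (0 : ℝ)) 0
  tendsto_div_atTop : Tendsto (fun x => Ψ x / x) atTop atTop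

/-- The Orlicz modular `∫ Ψ(|f|/C) dμ` (as an extended nonneg real). -/
def orliczModular {Ω : Type*} [MeasurableSpace Ω] (Ψ : ℝ → ℝ) (μ : Measure Ω)
    (f : Ω → ℂ) (C : ℝ) : ℝ≥0∞ :=
  ∫⁻ ω, ENNReal.ofReal (Ψ (‖f ω‖ / C)) ∂μ

/-- The Luxemburg norm. -/
def luxNorm {Ω : Type*} [MeasurableSpace Ω] (Ψ : ℝ → ℝ) (μ : Measure Ω) (f : Ω → ℂ) : ℝ :=
  sInf {C : ℝ | 0 < C ∧ orliczModular Ψ μ f C ≤ 1}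

/-- Membership in the Orlicz space `L^Ψ`. -/
def MemOrlicz {Ω : Type*} [MeasurableSpace Ω] (Ψ : ℝ → ℝ) (μ : Measure Ω) (f : Ω → ℂ) : Prop :=
  AEStronglyMeasurable f μ ∧ ∃ C > 0, orliczModular Ψ μ f C < ⊤

/-- Membership in the Morse–Transue space `M^Ψ` (the closure of `L^∞` in `L^Ψ`). -/
def MemMorseTransue {Ω : Type*} [MeasurableSpace Ω] (Ψ : ℝ → ℝ) (μ : Measure Ω)
    (f : Ω → ℂ) : Prop :=
  AEStronglyMeasurable f μ ∧ ∀ C > 0, orliczModular Ψ μ f C < ⊤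

/-- A subspace `X` is closed (in the Luxemburg norm) in the Morse–Transue space. -/
def IsLuxClosedIn {Ω : Type*} [MeasurableSpace Ω] (Ψ : ℝ → ℝ) (μ : Measure Ω)
    (X : Submodule ℂ (Ω → ℂ)) : Prop :=
  ∀ f : Ω → ℂ, MemMorseTransue Ψ μ f →
    (∀ ε > 0, ∃ g ∈ X, luxNorm Ψ μ (f - g) < ε) → f ∈ X

/-- A set in a normed space is relatively weakly compact. -/
def RelWeaklyCompact {Y : Type*} [NormedAddCommGroup Y] [NormedSpace ℂ Y] (S : Set Y) : Prop :=
  ∃ K : Set (WeakSpace ℂ Y), IsCompact K ∧ (toWeakSpace ℂ Y) '' S ⊆ K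

/-- The unit ball of a subspace `X` of `L^Ψ` for the Luxemburg norm. -/
def luxUnitBall {Ω : Type*} [MeasurableSpace Ω] (Ψ : ℝ → ℝ) (μ : Measure Ω)
    (X : Submodule ℂ (Ω → ℂ)) : Set X :=
  {f : X | luxNorm Ψ μ (f : Ω → ℂ) ≤ 1}

/-- An operator on a subspace of `L^Ψ` is weakly compact if the image of the unit ball is
relatively weakly compact. -/
def IsWeaklyCompactOp {Ω : Type*} [MeasurableSpace Ω] (Ψ : ℝ → ℝ) (μ : Measure Ω)
    {X : Submodule ℂ (Ω → ℂ)} {Y : Type*} [NormedAddCommGroup Y] [NormedSpace ℂ Y]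
    (T : X →ₗ[ℂ] Y) : Prop :=
  RelWeaklyCompact (⇑T '' luxUnitBall Ψ μ X)

/-- An operator on a subspace of `L^Ψ` is compact if the image of the unit ball is
relatively norm compact. -/
def IsCompactOp {Ω : Type*} [MeasurableSpace Ω] (Ψ : ℝ → ℝ) (μ : Measure Ω)
    {X : Submodule ℂ (Ω → ℂ)} {Y : Type*} [NormedAddCommGroup Y] [NormedSpace ℂ Y]
    (T : X →ₗ[ℂ] Y) : Prop :=
  IsCompact (closure (⇑T '' luxUnitBall Ψ μ X))

/-- `T` fixes a copy of `c₀`: there is a sequence in `X`, equivalent to the canonical basis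
of `c₀`, on whose (closed) span `T` is an isomorphism onto its image. -/
def FixesCopyOfC0 {Ω : Type*} [MeasurableSpace Ω] (Ψ : ℝ → ℝ) (μ : Measure Ω)
    {X : Submodule ℂ (Ω → ℂ)} {Y : Type*} [NormedAddCommGroup Y] [NormedSpace ℂ Y]
    (T : X →ₗ[ℂ] Y) : Prop :=
  ∃ (u : ℕ → X) (a b c : ℝ), 0 < a ∧ 0 < b ∧ 0 < c ∧
    ∀ (co : ℕ → ℂ) (s : Finset ℕ),
      a * (⨆ k ∈ s, ‖co k‖) ≤ luxNorm Ψ μ ((∑ k ∈ s, co k • u k : X) : Ω → ℂ) ∧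
      luxNorm Ψ μ ((∑ k ∈ s, co k • u k : X) : Ω → ℂ) ≤ b * (⨆ k ∈ s, ‖co k‖) ∧
      c * (⨆ k ∈ s, ‖co k‖) ≤ ‖T (∑ k ∈ s, co k • u k)‖

/-- The complementary (conjugate) Orlicz function `Φ(x) = sup_{y ≥ 0} (xy - Ψ(y))`. -/
def complementaryOrlicz (Ψ : ℝ → ℝ) (x : ℝ) : ℝ :=
  sSup ((fun y => x * y - Ψ y) '' Set.Ici (0 : ℝ))

/-- The `Δ₂` condition. -/
def Delta2 (Φ : ℝ → ℝ) : Prop :=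
  ∃ K > 0, ∃ x₀ > 0, ∀ x ≥ x₀, Φ (2 * x) ≤ K * Φ x

/-- The `Δ⁰` condition: for some `β > 1`, `Ψ(βx)/Ψ(x) → ∞` as `x → ∞`. -/
def Delta0 (Ψ : ℝ → ℝ) : Prop :=
  ∃ β > 1, Tendsto (fun x => Ψ (β * x) / Ψ x) atTop atTop

end

noncomputable section

namespace IsOrliczFunction

variable {Ψ : ℝ → ℝ}

theorem exists_subgradient (hΨ : IsOrliczFunction Ψ) {x : ℝ} (hx : 0 < x) :
    ∃ p : ℝ, ∀ y, 0 ≤ y → Ψ x + p * (y - x) ≤ Ψ y := by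
  have hc := hΨ.strictConvexOn.convexOn
  have hxi : x ∈ interior (Ici (0 : ℝ)) := by simpa using hx
  refine ⟨derivWithin Ψ (Ioi x) x, fun y hy => ?_⟩
  rcases lt_trichotomy x y with h | rfl | h
  · have := hc.rightDeriv_le_slope_of_mem_interior hxi hy h
    rw [slope_def_field, le_div_iff₀ (by linarith)] at this
    linarith
  · simp
  · have h1 := hc.slope_le_leftDeriv_of_mem_interior hy hxi h
    have h2 := hc.leftDeriv_le_rightDeriv_of_mem_interior hxi
    have := h1.trans h2
    rw [slope_def_field, div_le_iff₀ (by linarith)] at this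
    linarith

theorem map_smul_le (hΨ : IsOrliczFunction Ψ) {c x : ℝ} (hc : 0 ≤ c) (hc1 : c ≤ 1)
    (hx : 0 ≤ x) : Ψ (c * x) ≤ c * Ψ x := by
  have := hΨ.strictConvexOn.convexOn.2 (mem_Ici.2 hx) (mem_Ici.2 le_rfl) hc
    (sub_nonneg.2 hc1) (by ring)
  simpa [hΨ.map_zero] using this

theorem map_half_add_le (hΨ : IsOrliczFunction Ψ) {x y : ℝ} (hx : 0 ≤ x) (hy : 0 ≤ y) :
    Ψ ((x + y) / 2) ≤ (Ψ x + Ψ y) / 2 := by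
  have := hΨ.strictConvexOn.convexOn.2 (mem_Ici.2 hx) (mem_Ici.2 hy)
    (show (0 : ℝ) ≤ 1 / 2 by norm_num) (show (0 : ℝ) ≤ 1 / 2 by norm_num) (by norm_num)
  simp only [smul_eq_mul] at this
  rw [show (x + y) / 2 = 1 / 2 * x + 1 / 2 * y by ring]
  linarith

theorem pos (hΨ : IsOrliczFunction Ψ) {x : ℝ} (hx : 0 < x) : 0 < Ψ x := by
  have := hΨ.strictConvexOn.2 (mem_Ici.2 hx.le) (mem_Ici.2 le_rfl) hx.ne'
    (show (0 : ℝ) < 1 / 2 by norm_num) (show (0 : ℝ) < 1 / 2 by norm_num) (by norm_num)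
  have h2 := hΨ.nonneg ((1 / 2 : ℝ) • x + (1 / 2 : ℝ) • 0)
  simp only [smul_eq_mul, hΨ.map_zero] at this h2
  linarith

theorem bddAbove_complementary (hΨ : IsOrliczFunction Ψ) (x : ℝ) :
    BddAbove ((fun y => x * y - Ψ y) '' Ici (0 : ℝ)) := by
  obtain ⟨N, hN⟩ := (tendsto_atTop_atTop.1 hΨ.tendsto_div_atTop) x
  refine ⟨|x| * max N 0, ?_⟩
  rintro _ ⟨y, hy, rfl⟩
  have hy : 0 ≤ y := hy
  rcases le_or_gt y (max N 0) with h | h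
  · have h1 : x * y ≤ |x| * max N 0 :=
      mul_le_mul (le_abs_self x) h hy (abs_nonneg x)
    have := hΨ.nonneg y
    simp only
    linarith
  · have hy0 : 0 < y := lt_of_le_of_lt (le_max_right _ _) h
    have := hN y ((le_max_left _ _).trans h.le)
    rw [le_div_iff₀ hy0] at this
    have h3 : 0 ≤ |x| * max N 0 := by positivity
    simp only
    linarith

/-- If the complementary function is `Δ₂`, then `Ψ (2 x) ≥ a Ψ x` for large `x`, with `a > 2`. -/
theorem exists_doubling_lower_bound (hΨ : IsOrliczFunction Ψ)
    (hΦ : Delta2 (complementaryOrlicz Ψ)) :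
    ∃ a > 2, ∃ x₁ > 0, ∀ x ≥ x₁, a * Ψ x ≤ Ψ (2 * x) := by
  obtain ⟨K, hK, x₀, hx₀, h⟩ := hΦ
  set L := max K 3
  have hL : 3 ≤ L := le_max_right _ _
  obtain ⟨N, hN⟩ := (tendsto_atTop_atTop.1 hΨ.tendsto_div_atTop) x₀
  refine ⟨1 + (L - 1) / (L - 2), ?_, max N 1, lt_max_of_lt_right one_pos, fun x hx => ?_⟩
  · have : 1 < (L - 1) / (L - 2) := by rw [lt_div_iff₀] <;> linarith
    linarith
  have hx0 : 0 < x := lt_of_lt_of_le one_pos ((le_max_right _ _).trans hx)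
  obtain ⟨p, hp⟩ := hΨ.exists_subgradient hx0
  have hp0 := hp 0 le_rfl
  rw [hΨ.map_zero] at hp0
  have hpx : x₀ ≤ p := by
    have h1 := hN x ((le_max_left _ _).trans hx)
    rw [le_div_iff₀ hx0] at h1
    exact le_of_mul_le_mul_right (by linarith) hx0
  have h1 : complementaryOrlicz Ψ p ≤ p * x - Ψ x := by
    refine csSup_le ⟨_, 0, mem_Ici.2 le_rfl, rfl⟩ ?_
    rintro _ ⟨y, hy, rfl⟩
    have := hp y hy
    simp only
    linarith
  have h2 : 2 * p * x - Ψ x ≤ complementaryOrlicz Ψ (2 * p) :=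
    le_csSup (hΨ.bddAbove_complementary _) ⟨x, hx0.le, rfl⟩
  have h3 : 0 ≤ complementaryOrlicz Ψ p :=
    le_csSup (hΨ.bddAbove_complementary _) ⟨0, mem_Ici.2 le_rfl, by simp [hΨ.map_zero]⟩
  have h4 := h p hpx
  have h5 : K * complementaryOrlicz Ψ p ≤ L * (p * x - Ψ x) :=
    mul_le_mul (le_max_left _ _) h1 h3 (by linarith)
  have h6 : (L - 1) / (L - 2) * Ψ x ≤ p * x := by
    rw [div_mul_eq_mul_div, div_le_iff₀ (by linarith)]
    nlinarith
  have h7 := hp (2 * x) (by linarith)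
  linarith

theorem exists_power_growth (hΨ : IsOrliczFunction Ψ)
    (hΦ : Delta2 (complementaryOrlicz Ψ)) :
    ∃ q > (1 : ℝ), ∃ x₁ > 0, ∃ A > 0, ∀ x ≥ x₁, ∀ y ≥ x, Ψ x / x ^ q * y ^ q ≤ A * Ψ y := by
  obtain ⟨a, ha, x₁, hx₁, h⟩ := hΨ.exists_doubling_lower_bound hΦ
  have ha0 : 0 < a := by linarith
  refine ⟨Real.logb 2 a, ?_, x₁, hx₁, a, ha0, fun x hx y hy => ?_⟩
  · rw [gt_iff_lt, Real.lt_logb_iff_rpow_lt (by norm_num) ha0]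
    simpa using ha
  have hx0 : 0 < x := hx₁.trans_le hx
  have hy0 : 0 < y := hx0.trans_le hy
  have hq : (0 : ℝ) ≤ Real.logb 2 a := Real.logb_nonneg (by norm_num) (by linarith)
  obtain ⟨k, hk1, hk2⟩ := exists_nat_pow_near (x := y / x) (y := (2 : ℝ))
    (by rwa [le_div_iff₀ hx0, one_mul]) (by norm_num)
  have hpow : ∀ k : ℕ, a ^ k * Ψ x ≤ Ψ (2 ^ k * x) := by
    intro k
    induction k with
    | zero => simp
    | succ k ih =>
      have h1 := h (2 ^ k * x) (hx.trans (le_mul_of_one_le_left hx0.le (one_le_pow₀ (by norm_num))))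
      calc a ^ (k + 1) * Ψ x = a * (a ^ k * Ψ x) := by ring
        _ ≤ a * Ψ (2 ^ k * x) := by gcongr
        _ ≤ _ := h1
        _ = _ := by ring_nf
  have h2 : Ψ (2 ^ k * x) ≤ Ψ y := by
    apply hΨ.mono (mem_Ici.2 (by positivity)) (mem_Ici.2 hy0.le)
    rwa [← le_div_iff₀ hx0]
  have h3 : (y / x) ^ Real.logb 2 a ≤ a * a ^ k := by
    calc (y / x) ^ Real.logb 2 a ≤ ((2 : ℝ) ^ (k + 1)) ^ Real.logb 2 a :=
          Real.rpow_le_rpow (by positivity) hk2.le hq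
      _ = ((2 : ℝ) ^ Real.logb 2 a) ^ (k + 1) := by
          rw [← Real.rpow_natCast, ← Real.rpow_mul (by norm_num), mul_comm,
            Real.rpow_mul (by norm_num), Real.rpow_natCast]
      _ = a * a ^ k := by
          rw [Real.rpow_logb (by norm_num) (by norm_num) ha0]; ring
  calc Ψ x / x ^ Real.logb 2 a * y ^ Real.logb 2 a = (y / x) ^ Real.logb 2 a * Ψ x := by
        rw [Real.div_rpow hy0.le hx0.le]; ring
    _ ≤ a * a ^ k * Ψ x := by gcongr; exact hΨ.nonneg x
    _ = a * (a ^ k * Ψ x) := by ring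
    _ ≤ a * Ψ y := by gcongr; exact (hpow k).trans h2

end IsOrliczFunction

theorem IsOrliczFunction.measurable_comp_max {Ψ : ℝ → ℝ} (hΨ : IsOrliczFunction Ψ) :
    Measurable fun x => Ψ (max x 0) :=
  Monotone.measurable fun _ _ h => hΨ.mono (mem_Ici.2 (le_max_right _ _))
    (mem_Ici.2 (le_max_right _ _)) (max_le_max h le_rfl)

section Modular

variable {Ω : Type*} [MeasurableSpace Ω] {μ : Measure Ω} {Ψ : ℝ → ℝ} {f g : Ω → ℂ} {c : ℝ}

theorem IsOrliczFunction.aestronglyMeasurable_comp (hΨ : IsOrliczFunction Ψ) {r : Ω → ℝ}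
    (hr : AEMeasurable r μ) (hr0 : ∀ ω, 0 ≤ r ω) : AEStronglyMeasurable (fun ω => Ψ (r ω)) μ := by
  have := (hΨ.measurable_comp_max.comp_aemeasurable hr).aestronglyMeasurable
  simpa only [Function.comp_def, max_eq_left (hr0 _)] using this

namespace MemMorseTransue

theorem integrable (hΨ : IsOrliczFunction Ψ) (hf : MemMorseTransue Ψ μ f) (hc : 0 ≤ c) :
    Integrable (fun ω => Ψ (c * ‖f ω‖)) μ := by
  rcases hc.eq_or_lt with rfl | hc
  · simp [hΨ.map_zero]
  refine ⟨hΨ.aestronglyMeasurable_comp (hf.1.norm.aemeasurable.const_mul c)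
    fun ω => by positivity, ?_⟩
  rw [hasFiniteIntegral_iff_ofReal (Eventually.of_forall fun ω => hΨ.nonneg _)]
  have := hf.2 c⁻¹ (inv_pos.2 hc)
  simpa only [orliczModular, div_inv_eq_mul, mul_comm] using this

theorem orliczModular_eq (hΨ : IsOrliczFunction Ψ) (hf : MemMorseTransue Ψ μ f) (hc : 0 ≤ c) :
    orliczModular Ψ μ f c⁻¹ = ENNReal.ofReal (∫ ω, Ψ (c * ‖f ω‖) ∂μ) := by
  rw [ofReal_integral_eq_lintegral_ofReal (hf.integrable hΨ hc)
    (Eventually.of_forall fun ω => hΨ.nonneg _)]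
  simp only [orliczModular, div_inv_eq_mul, mul_comm]

theorem luxNorm_le (hΨ : IsOrliczFunction Ψ) (hf : MemMorseTransue Ψ μ f) (hc : 0 < c)
    (h : ∫ ω, Ψ (c * ‖f ω‖) ∂μ ≤ 1) : luxNorm Ψ μ f ≤ c⁻¹ := by
  refine csInf_le ⟨0, fun C hC => hC.1.le⟩ ⟨inv_pos.2 hc, ?_⟩
  rw [hf.orliczModular_eq hΨ hc.le]
  simpa using h

theorem integral_le_one (hΨ : IsOrliczFunction Ψ) (hf : MemMorseTransue Ψ μ f) (hc : 0 < c)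
    (h : luxNorm Ψ μ f < c⁻¹) : ∫ ω, Ψ (c * ‖f ω‖) ∂μ ≤ 1 := by
  have hne : {C : ℝ | 0 < C ∧ orliczModular Ψ μ f C ≤ 1}.Nonempty := by
    set I := ∫ ω, Ψ (1 * ‖f ω‖) ∂μ
    have hI : 0 < max 1 I := lt_max_of_lt_left one_pos
    refine ⟨(max 1 I)⁻¹⁻¹, by simp, ?_⟩
    rw [hf.orliczModular_eq hΨ (inv_pos.2 hI).le, ENNReal.ofReal_le_one]
    calc ∫ ω, Ψ ((max 1 I)⁻¹ * ‖f ω‖) ∂μ ≤ ∫ ω, (max 1 I)⁻¹ * Ψ (1 * ‖f ω‖) ∂μ := by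
          refine integral_mono (hf.integrable hΨ (inv_pos.2 hI).le)
            ((hf.integrable hΨ zero_le_one).const_mul _) fun ω => ?_
          simpa using hΨ.map_smul_le (inv_pos.2 hI).le (inv_le_one_of_one_le₀ (le_max_left _ _))
            (norm_nonneg (f ω))
      _ = (max 1 I)⁻¹ * I := integral_const_mul _ _
      _ ≤ 1 := by
          rw [inv_mul_le_iff₀ hI, mul_one]
          exact le_max_right _ _
  obtain ⟨C, ⟨hC, hC1⟩, hCc⟩ := exists_lt_of_csInf_lt hne h
  rw [← inv_inv C, hf.orliczModular_eq hΨ (inv_pos.2 hC).le, ENNReal.ofReal_le_one] at hC1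
  refine le_trans (integral_mono (hf.integrable hΨ hc.le)
    (hf.integrable hΨ (inv_pos.2 hC).le) fun ω => ?_) hC1
  refine hΨ.mono (mem_Ici.2 (by positivity)) (mem_Ici.2 (by positivity)) ?_
  gcongr
  exact (lt_inv_comm₀ hC hc).1 hCc |>.le

end MemMorseTransue

theorem luxNorm_nonneg : 0 ≤ luxNorm Ψ μ f :=
  Real.sInf_nonneg fun _ hC => hC.1.le

end Modular

theorem Complex.norm_half_add_rpow_lt {q : ℝ} (hq : 1 < q) {z w : ℂ} (hzw : z ≠ w) :
    (‖z + w‖ / 2) ^ q < (‖z‖ ^ q + ‖w‖ ^ q) / 2 := by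
  have hsc := strictConvexOn_rpow hq
  have hle : ‖z + w‖ / 2 ≤ (‖z‖ + ‖w‖) / 2 := by linarith [norm_add_le z w]
  rcases eq_or_ne ‖z‖ ‖w‖ with h | h
  · have hlt : ‖z + w‖ / 2 < ‖z‖ := by
      have h1 : ¬ SameRay ℝ z w := fun hs => hzw (hs.norm_eq_iff.1 h)
      have := (not_sameRay_iff_norm_add_lt).1 h1
      linarith
    have := Real.rpow_lt_rpow (by positivity) hlt (by linarith : 0 < q)
    rw [← h]
    linarith
  · have h1 := hsc.2 (mem_Ici.2 (norm_nonneg z)) (mem_Ici.2 (norm_nonneg w)) h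
      (show (0 : ℝ) < 1 / 2 by norm_num) (show (0 : ℝ) < 1 / 2 by norm_num) (by norm_num)
    simp only [smul_eq_mul] at h1
    have h2 := Real.rpow_le_rpow (by positivity) hle (by linarith : 0 ≤ q)
    rw [show (‖z‖ + ‖w‖) / 2 = 1 / 2 * ‖z‖ + 1 / 2 * ‖w‖ by ring] at h2
    linarith

/-- Uniform convexity of `z ↦ ‖z‖ ^ q` on the complex plane for `q > 1`. -/
theorem Complex.exists_norm_half_add_rpow_le {q : ℝ} (hq : 1 < q) {ε : ℝ} (hε : 0 < ε) :
    ∃ p > 0, p ≤ 1 ∧ ∀ z w : ℂ, ε * max ‖z‖ ‖w‖ ≤ ‖z - w‖ →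
      (‖z + w‖ / 2) ^ q ≤ (1 - p) * ((‖z‖ ^ q + ‖w‖ ^ q) / 2) := by
  have hq0 : 0 < q := by linarith
  let S : Set (ℂ × ℂ) := {x | max ‖x.1‖ ‖x.2‖ = 1 ∧ ε ≤ ‖x.1 - x.2‖}
  let D : ℂ × ℂ → ℝ := fun x => (‖x.1‖ ^ q + ‖x.2‖ ^ q) / 2 - (‖x.1 + x.2‖ / 2) ^ q
  have hS : IsCompact S := by
    apply Metric.isCompact_of_isClosed_isBounded
    · apply IsClosed.inter
      · exact isClosed_eq (by fun_prop) continuous_const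
      · exact isClosed_le continuous_const (show Continuous fun x : ℂ × ℂ => ‖x.1 - x.2‖ by fun_prop)
    · refine (Metric.isBounded_closedBall (x := (0 : ℂ × ℂ)) (r := 1)).subset ?_
      rintro ⟨z, w⟩ ⟨h, -⟩
      simpa [Prod.norm_def] using h.le
  have hD : Continuous D := by
    have h1 : Continuous fun t : ℝ => t ^ q := Real.continuous_rpow_const hq0.le
    exact (((h1.comp (continuous_norm.comp continuous_fst)).add
      (h1.comp (continuous_norm.comp continuous_snd))).div_const 2).sub
        (h1.comp (show Continuous fun x : ℂ × ℂ => ‖x.1 + x.2‖ / 2 by fun_prop))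
  have hDpos : ∀ x ∈ S, 0 < D x := by
    rintro ⟨z, w⟩ ⟨-, h⟩
    have hne : z ≠ w := by
      rintro rfl
      simp only [sub_self, norm_zero] at h
      linarith
    exact sub_pos.2 (Complex.norm_half_add_rpow_lt hq hne)
  obtain ⟨p, hp, hpD⟩ : ∃ p > 0, ∀ x ∈ S, p ≤ D x := by
    rcases S.eq_empty_or_nonempty with h | h
    · exact ⟨1, one_pos, by simp [h]⟩
    · obtain ⟨x, hx, hmin⟩ := hS.exists_isMinOn h hD.continuousOn
      exact ⟨D x, hDpos x hx, fun y hy => hmin hy⟩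
  refine ⟨min p 1, lt_min hp one_pos, min_le_right _ _, fun z w h => ?_⟩
  set R := max ‖z‖ ‖w‖ with hR
  rcases (le_max_of_le_left (norm_nonneg z) : 0 ≤ R).eq_or_lt with h0 | h0
  · have hz : z = 0 := norm_le_zero_iff.1 (h0 ▸ le_max_left _ _)
    have hw : w = 0 := norm_le_zero_iff.1 (h0 ▸ le_max_right _ _)
    simp [hz, hw, Real.zero_rpow hq0.ne']
  replace h0 : 0 < R := h0
  have hnorm : ∀ v : ℂ, ‖(R : ℂ)⁻¹ * v‖ = R⁻¹ * ‖v‖ := fun v => by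
    rw [norm_mul, norm_inv, Complex.norm_real, Real.norm_of_nonneg h0.le]
  have hmem : ((R : ℂ)⁻¹ * z, (R : ℂ)⁻¹ * w) ∈ S := by
    constructor
    · simp only [hnorm]
      rw [← mul_max_of_nonneg _ _ (inv_nonneg.2 h0.le), ← hR, inv_mul_cancel₀ h0.ne']
    · simp only [← mul_sub, hnorm]
      rw [← div_eq_inv_mul, le_div_iff₀ h0]
      exact h
  have key := hpD _ hmem
  simp only [D, ← mul_add, hnorm, mul_div_assoc] at key
  rw [Real.mul_rpow (by positivity) (by positivity), Real.mul_rpow (by positivity) (by positivity),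
    Real.mul_rpow (by positivity) (by positivity)] at key
  have hRq : 0 < R ^ q := Real.rpow_pos_of_pos h0 q
  rw [Real.inv_rpow h0.le, ← mul_add, mul_div_assoc, ← mul_sub, ← div_eq_inv_mul,
    le_div_iff₀ hRq] at key
  have hzq : ‖z‖ ^ q ≤ R ^ q := Real.rpow_le_rpow (norm_nonneg _) (le_max_left _ _) hq0.le
  have hwq : ‖w‖ ^ q ≤ R ^ q := Real.rpow_le_rpow (norm_nonneg _) (le_max_right _ _) hq0.le
  have h3 : min p 1 * ((‖z‖ ^ q + ‖w‖ ^ q) / 2) ≤ p * R ^ q :=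
    mul_le_mul (min_le_left _ _) (by linarith) (by positivity) hp.le
  linarith

theorem IsOrliczFunction.exists_convex_rpow_equiv {Ψ : ℝ → ℝ} (hΨ : IsOrliczFunction Ψ)
    (hΦ : Delta2 (complementaryOrlicz Ψ)) :
    ∃ q > (1 : ℝ), ∃ Θ : ℝ → ℝ, Monotone Θ ∧ ConvexOn ℝ univ Θ ∧ Θ 0 = 0 ∧
      (∀ u, 0 ≤ u → u ≤ Θ u) ∧ (∃ A > 0, ∀ x, 0 ≤ x → Θ (x ^ q) ≤ A * (Ψ x + 1)) ∧
      ∃ x₁ > 0, ∀ x ≥ x₁, Ψ x ≤ Θ ((2 * x) ^ q) := by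
  obtain ⟨q, hq, x₁, hx₁, A, hA, h⟩ := hΨ.exists_power_growth hΦ
  have hq0 : 0 < q := by linarith
  let g : Ici x₁ → ℝ → ℝ := fun t u => Ψ t / (t : ℝ) ^ q * max (u - (t : ℝ) ^ q) 0
  have hpos : ∀ t : Ici x₁, 0 < (t : ℝ) := fun t => hx₁.trans_le t.2
  have hc : ∀ t : Ici x₁, 0 ≤ Ψ t / (t : ℝ) ^ q := fun t =>
    div_nonneg (hΨ.nonneg _) (Real.rpow_nonneg (hpos t).le _)
  have hg0 : ∀ t u, 0 ≤ g t u := fun t u => mul_nonneg (hc t) (le_max_right _ _)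
  have hgx : ∀ t x, 0 ≤ x → g t (x ^ q) ≤ A * Ψ x := by
    intro t x hx
    rcases le_total x t with hxt | hxt
    · have : x ^ q - (t : ℝ) ^ q ≤ 0 := sub_nonpos.2 (Real.rpow_le_rpow hx hxt hq0.le)
      simp only [g, max_eq_right this, mul_zero]
      exact mul_nonneg hA.le (hΨ.nonneg _)
    · refine le_trans (mul_le_mul_of_nonneg_left ?_ (hc t)) (h t t.2 x hxt)
      have := Real.rpow_nonneg (hpos t).le q
      exact max_le (by linarith) (Real.rpow_nonneg hx q)
  have hgmono : ∀ t, Monotone (g t) := fun t u v huv =>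
    mul_le_mul_of_nonneg_left (max_le_max (by linarith) le_rfl) (hc t)
  have hbdd : ∀ u, BddAbove (range fun t => g t u) := by
    intro u
    refine ⟨A * Ψ ((max u 0) ^ q⁻¹), ?_⟩
    rintro _ ⟨t, rfl⟩
    refine le_trans (hgmono t (le_max_left u 0)) ?_
    have := hgx t ((max u 0) ^ q⁻¹) (by positivity)
    rwa [Real.rpow_inv_rpow (le_max_right _ _) hq0.ne'] at this
  have : Nonempty (Ici x₁) := ⟨⟨x₁, mem_Ici.2 le_rfl⟩⟩
  have hS0 : ∀ u, 0 ≤ ⨆ t, g t u := fun u => Real.iSup_nonneg fun t => hg0 t u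
  refine ⟨q, hq, fun u => u + ⨆ t, g t u, ?_, ?_, ?_, ?_, ?_, ?_⟩
  · intro u v huv
    exact add_le_add huv (ciSup_mono (hbdd v) fun t => hgmono t huv)
  · refine ⟨convex_univ, fun u _ v _ a b ha hb hab => ?_⟩
    simp only [smul_eq_mul]
    have key : ⨆ t, g t (a * u + b * v) ≤ a * (⨆ t, g t u) + b * ⨆ t, g t v := by
      refine ciSup_le fun t => ?_
      have h1 := mul_le_mul_of_nonneg_left (le_ciSup (hbdd u) t) ha
      have h2 := mul_le_mul_of_nonneg_left (le_ciSup (hbdd v) t) hb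
      have h3 : max (a * u + b * v - (t : ℝ) ^ q) 0 ≤
          a * max (u - (t : ℝ) ^ q) 0 + b * max (v - (t : ℝ) ^ q) 0 := by
        have e1 := mul_le_mul_of_nonneg_left (le_max_left (u - (t : ℝ) ^ q) 0) ha
        have e2 := mul_le_mul_of_nonneg_left (le_max_left (v - (t : ℝ) ^ q) 0) hb
        refine max_le ?_ (by positivity)
        have e3 : (t : ℝ) ^ q = a * (t : ℝ) ^ q + b * (t : ℝ) ^ q := by
          rw [← add_mul, hab, one_mul]
        linarith
      have h4 := mul_le_mul_of_nonneg_left h3 (hc t)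
      simp only [g] at h1 h2 h4 ⊢
      linarith
    linarith
  · have : ∀ t, g t 0 = 0 := fun t => by
      have := Real.rpow_nonneg (hpos t).le q
      simp only [g, max_eq_right (show 0 - (t : ℝ) ^ q ≤ 0 by linarith), mul_zero]
    simp [this]
  · intro u hu
    have := hS0 u
    simp only
    linarith
  · have hΨ1 := hΨ.pos hx₁
    have hxq : 0 < x₁ ^ q := Real.rpow_pos_of_pos hx₁ q
    set B := A * x₁ ^ q / Ψ x₁ with hB
    have hB0 : 0 < B := by positivity
    refine ⟨A + B + x₁ ^ q, by positivity, fun x hx => ?_⟩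
    have hΨx := hΨ.nonneg x
    have h1 : ⨆ t, g t (x ^ q) ≤ A * Ψ x := ciSup_le fun t => hgx t x hx
    have h2 : x ^ q ≤ B * Ψ x + x₁ ^ q := by
      rcases le_total x x₁ with hxx | hxx
      · have := Real.rpow_le_rpow hx hxx hq0.le
        have : 0 ≤ B * Ψ x := by positivity
        linarith
      · have := h x₁ le_rfl x hxx
        have h3 : x ^ q ≤ B * Ψ x := by
          rw [hB, div_mul_eq_mul_div, le_div_iff₀ hΨ1]
          rw [div_mul_eq_mul_div, div_le_iff₀ hxq] at this
          linarith
        linarith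
    have h3 : 0 ≤ x₁ ^ q * Ψ x := by positivity
    simp only
    linarith
  · refine ⟨x₁, hx₁, fun x hx => ?_⟩
    have hx0 : 0 < x := hx₁.trans_le hx
    have hxq : 0 < x ^ q := Real.rpow_pos_of_pos hx0 q
    have h2q : (2 : ℝ) ≤ 2 ^ q := Real.self_le_rpow_of_one_le (by norm_num) hq.le
    have h1 := le_ciSup (hbdd ((2 * x) ^ q)) ⟨x, hx⟩
    have h2 : Ψ x ≤ g ⟨x, hx⟩ ((2 * x) ^ q) := by
      simp only [g]
      rw [div_mul_eq_mul_div, le_div_iff₀ hxq]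
      refine mul_le_mul_of_nonneg_left (le_max_of_le_left ?_) (hΨ.nonneg x)
      rw [Real.mul_rpow (by norm_num) hx0.le]
      nlinarith
    have h3 : 0 ≤ (2 * x) ^ q := by positivity
    simp only at h1 ⊢
    linarith

/-- A `∇₂` Orlicz function is dominated by the convexity defect of some measurable `G`. -/
theorem IsOrliczFunction.exists_convexity_defect {Ψ : ℝ → ℝ} (hΨ : IsOrliczFunction Ψ)
    (hΦ : Delta2 (complementaryOrlicz Ψ)) :
    ∃ G : ℝ → ℝ, Measurable G ∧ (∀ x, 0 ≤ G x) ∧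
      (∃ A > 0, ∀ x, 0 ≤ x → G x ≤ A * (Ψ x + 1)) ∧
      ∀ θ > 0, ∃ C > 0, ∀ z w : ℂ, Ψ (‖z - w‖ / 4) ≤
        C * ((G ‖z‖ + G ‖w‖) / 2 - G (‖z + w‖ / 2)) + θ * (1 + Ψ ‖z‖ + Ψ ‖w‖) := by
  obtain ⟨q, hq, Θ, hmono, hconv, hΘ0, hΘid, ⟨A, hA, hΘA⟩, x₁, hx₁, hΘx⟩ :=
    hΨ.exists_convex_rpow_equiv hΦ
  have hq0 : 0 < q := by linarith
  have hΘnn : ∀ u, 0 ≤ u → 0 ≤ Θ u := fun u hu => hu.trans (hΘid u hu)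
  have hΘsmul : ∀ c u, 0 ≤ c → c ≤ 1 → Θ (c * u) ≤ c * Θ u := fun c u hc hc1 => by
    have := hconv.2 (mem_univ u) (mem_univ 0) hc (sub_nonneg.2 hc1) (by ring)
    simpa [hΘ0] using this
  have hΘavg : ∀ u v, Θ ((u + v) / 2) ≤ (Θ u + Θ v) / 2 := fun u v => by
    have := hconv.2 (mem_univ u) (mem_univ v) (show (0 : ℝ) ≤ 1 / 2 by norm_num)
      (show (0 : ℝ) ≤ 1 / 2 by norm_num) (by norm_num)
    simp only [smul_eq_mul] at this
    rw [show (u + v) / 2 = 1 / 2 * u + 1 / 2 * v by ring]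
    linarith
  have hG : ∀ x : ℝ, 0 ≤ x → Θ ((max x 0) ^ q) = Θ (x ^ q) := fun x hx => by
    rw [max_eq_left hx]
  have hmax : ∀ x : ℝ, 0 ≤ (max x 0) ^ q := fun x => Real.rpow_nonneg (le_max_right _ _) q
  refine ⟨fun x => Θ ((max x 0) ^ q), ?_, fun x => hΘnn _ (hmax x), ⟨A, hA, fun x hx => ?_⟩, ?_⟩
  · refine Monotone.measurable fun x y hxy => hmono ?_
    exact Real.rpow_le_rpow (le_max_right _ _) (max_le_max hxy le_rfl) hq0.le
  · simpa only [hG x hx] using hΘA x hx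
  intro θ hθ
  have hΨ1 := hΨ.pos hx₁
  obtain ⟨δ, hδ, hδθ⟩ : ∃ δ > 0, Ψ δ ≤ θ / 2 := by
    refine ⟨min 1 (θ / 2 / Ψ x₁) * x₁, by positivity, ?_⟩
    refine (hΨ.map_smul_le (by positivity) (min_le_left _ _) hx₁.le).trans ?_
    calc min 1 (θ / 2 / Ψ x₁) * Ψ x₁ ≤ θ / 2 / Ψ x₁ * Ψ x₁ := by gcongr; exact min_le_right _ _
      _ = θ / 2 := by field_simp
  have hδq : 0 < δ ^ q := Real.rpow_pos_of_pos hδ q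
  set B := 1 + Ψ x₁ / δ ^ q with hB
  have hB1 : 1 ≤ B := by
    have : 0 ≤ Ψ x₁ / δ ^ q := by positivity
    linarith
  have hsmall : ∀ m, 0 ≤ m → Ψ (m / 2) ≤ θ / 2 + B * Θ (m ^ q) := by
    intro m hm
    have hmq : 0 ≤ m ^ q := Real.rpow_nonneg hm q
    have hΘm := hΘnn _ hmq
    rcases le_or_gt x₁ (m / 2) with h1 | h1
    · have := hΘx _ h1
      rw [show 2 * (m / 2) = m by ring] at this
      nlinarith
    rcases le_or_gt (m / 2) δ with h2 | h2
    · have h3 := hΨ.mono (mem_Ici.2 (by positivity)) (mem_Ici.2 hδ.le) h2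
      have : 0 ≤ B * Θ (m ^ q) := by positivity
      linarith
    · have h3 := hΨ.mono (mem_Ici.2 (by positivity)) (mem_Ici.2 hx₁.le) h1.le
      have h4 : δ ^ q ≤ Θ (m ^ q) :=
        (Real.rpow_le_rpow hδ.le (by linarith) hq0.le).trans (hΘid _ hmq)
      have h5 : Ψ x₁ ≤ Ψ x₁ / δ ^ q * Θ (m ^ q) := by
        rw [div_mul_eq_mul_div, le_div_iff₀ hδq]
        gcongr
      rw [hB, add_mul, one_mul]
      linarith
  set ε := min 1 (θ / (4 * A * B)) with hε
  have hε0 : 0 < ε := by positivity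
  have hε1 : ε ≤ 1 := min_le_left _ _
  have hεθ : B * (ε * (2 * A)) ≤ θ / 2 := by
    have : ε ≤ θ / (4 * A * B) := min_le_right _ _
    rw [le_div_iff₀ (by positivity)] at this
    linarith
  obtain ⟨p, hp, hp1, hunif⟩ := Complex.exists_norm_half_add_rpow_le hq hε0
  refine ⟨B * (2 / p), by positivity, fun z w => ?_⟩
  simp only [hG _ (norm_nonneg _), hG _ (by positivity : 0 ≤ ‖z + w‖ / 2)]
  set Z := Θ (‖z‖ ^ q)
  set W := Θ (‖w‖ ^ q)
  set V := Θ ((‖z + w‖ / 2) ^ q)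
  have hZ : 0 ≤ Z := hΘnn _ (by positivity)
  have hW : 0 ≤ W := hΘnn _ (by positivity)
  have hΨz := hΨ.nonneg ‖z‖
  have hΨw := hΨ.nonneg ‖w‖
  have hVavg : V ≤ (Z + W) / 2 := by
    refine le_trans (hmono ?_) (hΘavg _ _)
    rcases eq_or_ne z w with rfl | h
    · rw [← two_mul, norm_mul, Complex.norm_ofNat, mul_div_cancel_left₀ _ two_ne_zero]
      linarith
    · exact (Complex.norm_half_add_rpow_lt hq h).le
  have hmaxZW : Θ ((max ‖z‖ ‖w‖) ^ q) ≤ Z + W := by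
    rcases max_choice ‖z‖ ‖w‖ with h | h <;> rw [h] <;> linarith
  have key : Θ ((‖z - w‖ / 2) ^ q) ≤
      2 / p * ((Z + W) / 2 - V) + ε * (2 * A) * (1 + Ψ ‖z‖ + Ψ ‖w‖) := by
    have hm : ‖z - w‖ / 2 ≤ max ‖z‖ ‖w‖ := by
      have := norm_sub_le z w
      have := le_max_left ‖z‖ ‖w‖
      have := le_max_right ‖z‖ ‖w‖
      linarith
    rcases le_or_gt (ε * max ‖z‖ ‖w‖) ‖z - w‖ with h | h
    · have h1 : V ≤ (1 - p) * ((Z + W) / 2) := by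
        refine (hmono (hunif z w h)).trans ((hΘsmul _ _ (by linarith) (by linarith)).trans ?_)
        exact mul_le_mul_of_nonneg_left (hΘavg _ _) (by linarith)
      have h2 : Θ ((‖z - w‖ / 2) ^ q) ≤ Z + W :=
        (hmono (Real.rpow_le_rpow (by positivity) hm hq0.le)).trans hmaxZW
      have h3 : Z + W ≤ 2 / p * ((Z + W) / 2 - V) := by
        rw [div_mul_eq_mul_div, le_div_iff₀ hp]
        linarith
      have h4 : 0 ≤ ε * (2 * A) * (1 + Ψ ‖z‖ + Ψ ‖w‖) := by positivity
      linarith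
    · have h1 : (‖z - w‖ / 2) ^ q ≤ ε * (max ‖z‖ ‖w‖) ^ q := by
        calc (‖z - w‖ / 2) ^ q ≤ (ε * max ‖z‖ ‖w‖) ^ q :=
              Real.rpow_le_rpow (by positivity) (by linarith [norm_nonneg (z - w)]) hq0.le
          _ = ε ^ q * (max ‖z‖ ‖w‖) ^ q := Real.mul_rpow hε0.le (by positivity)
          _ ≤ ε * (max ‖z‖ ‖w‖) ^ q := by
              gcongr
              simpa using Real.rpow_le_rpow_of_exponent_ge hε0 hε1 hq.le
      have h2 : Θ ((‖z - w‖ / 2) ^ q) ≤ ε * (Z + W) :=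
        (hmono h1).trans ((hΘsmul _ _ hε0.le hε1).trans
          (mul_le_mul_of_nonneg_left hmaxZW hε0.le))
      have h3 : Z + W ≤ 2 * A * (1 + Ψ ‖z‖ + Ψ ‖w‖) := by
        have e1 := hΘA ‖z‖ (norm_nonneg _)
        have e2 := hΘA ‖w‖ (norm_nonneg _)
        have e3 : 0 ≤ A * Ψ ‖z‖ := by positivity
        have e4 : 0 ≤ A * Ψ ‖w‖ := by positivity
        linarith
      have h4 : 0 ≤ 2 / p * ((Z + W) / 2 - V) := mul_nonneg (by positivity) (by linarith)
      have h5 := mul_le_mul_of_nonneg_left h3 hε0.le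
      linarith
  have h1 := hsmall (‖z - w‖ / 2) (by positivity)
  rw [show ‖z - w‖ / 2 / 2 = ‖z - w‖ / 4 by ring] at h1
  have h2 := mul_le_mul_of_nonneg_left key (by linarith : 0 ≤ B)
  have h3 := mul_le_mul_of_nonneg_right hεθ (by positivity : 0 ≤ 1 + Ψ ‖z‖ + Ψ ‖w‖)
  have h4 : 0 ≤ θ * Ψ ‖z‖ := by positivity
  have h5 : 0 ≤ θ * Ψ ‖w‖ := by positivity
  linarith

/-- The image under a linear map of a midpoint-convex set `B` is relatively weakly compact as
soon as the map is controlled by the convexity defect of some bounded function on `B`. -/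
theorem relWeaklyCompact_image_of_convexity_defect {V Y : Type*} [AddCommGroup V] [Module ℂ V]
    [NormedAddCommGroup Y] [NormedSpace ℂ Y] [CompleteSpace Y] (T : V →ₗ[ℂ] Y) {B : Set V}
    (hB : ∀ f ∈ B, ∀ g ∈ B, (1 / 2 : ℂ) • (f + g) ∈ B) {M : ℝ} (hM : ∀ f ∈ B, ‖T f‖ ≤ M)
    {F : V → ℝ} (hF0 : ∀ f ∈ B, 0 ≤ F f) {b : ℝ} (hFb : ∀ f ∈ B, F f ≤ b)
    (hF : ∀ η > 0, ∃ γ > 0, ∀ f ∈ B, ∀ g ∈ B,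
      (F f + F g) / 2 - F ((1 / 2 : ℂ) • (f + g)) ≤ γ → ‖T (f - g)‖ ≤ η) :
    RelWeaklyCompact (T '' B) := by
  refine ⟨closure (toWeakSpace ℂ Y '' (T '' B)), ?_, subset_closure⟩
  refine NormedSpace.isCompact_closure_of_isBounded ℂ Y _ ?_ fun x hx => ?_
  · refine (Metric.isBounded_closedBall (x := (0 : Y)) (r := M)).subset ?_
    rintro y ⟨_, ⟨f, hf, rfl⟩, h⟩
    rw [← (toWeakSpace ℂ Y).injective h]
    simpa using hM f hf
  let N : Finset (StrongDual ℂ Y) → ℝ → Set V :=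
    fun s δ => {f | f ∈ B ∧ ∀ φ ∈ s, ‖φ (T f) - x φ‖ < δ}
  have hN : ∀ s, ∀ δ > 0, (N s δ).Nonempty := by
    intro s δ hδ
    have hopen : IsOpen (⋂ φ ∈ s, {y : WeakDual ℂ (StrongDual ℂ Y) | ‖y φ - x φ‖ < δ}) :=
      isOpen_biInter_finset fun φ _ =>
        isOpen_lt (((WeakDual.eval_continuous φ).sub continuous_const).norm) continuous_const
    obtain ⟨y, hy, _, ⟨_, ⟨f, hf, rfl⟩, rfl⟩, rfl⟩ := mem_closure_iff.1 hx _ hopen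
      (by simp [hδ])
    refine ⟨f, hf, fun φ hφ => ?_⟩
    exact mem_iInter₂.1 hy φ hφ
  have hNmid : ∀ s δ, ∀ f ∈ N s δ, ∀ g ∈ N s δ, (1 / 2 : ℂ) • (f + g) ∈ N s δ := by
    rintro s δ f ⟨hf, hf'⟩ g ⟨hg, hg'⟩
    refine ⟨hB f hf g hg, fun φ hφ => ?_⟩
    have e : φ (T ((1 / 2 : ℂ) • (f + g))) - x φ =
        (1 / 2 : ℂ) * ((φ (T f) - x φ) + (φ (T g) - x φ)) := by
      simp only [map_smul, map_add, smul_eq_mul]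
      ring
    have h1 := norm_add_le (φ (T f) - x φ) (φ (T g) - x φ)
    have h2 := hf' φ hφ
    have h3 := hg' φ hφ
    rw [e, norm_mul]
    norm_num
    linarith
  let L : Set ℝ := {c | ∃ s, ∃ δ > 0, ∀ f ∈ N s δ, c ≤ F f}
  have hL : BddAbove L := by
    refine ⟨b, ?_⟩
    rintro c ⟨s, δ, hδ, h⟩
    obtain ⟨f, hf⟩ := hN s δ hδ
    exact (h f hf).trans (hFb f hf.1)
  have hLne : L.Nonempty := ⟨0, ∅, 1, one_pos, fun f hf => hF0 f hf.1⟩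
  have happrox : ∀ η > 0, ∃ y : Y,
      ‖NormedSpace.inclusionInDoubleDual ℂ Y y - WeakDual.toStrongDual x‖ ≤ η := by
    intro η hη
    obtain ⟨γ, hγ, h⟩ := hF η hη
    obtain ⟨c, ⟨s, δ, hδ, hc⟩, hc'⟩ := exists_lt_of_lt_csSup hLne
      (show sSup L - γ / 2 < sSup L by linarith)
    have hlow : ∀ s', ∀ δ' > 0, ∃ f ∈ N s' δ', F f < sSup L + γ / 2 := by
      intro s' δ' hδ'
      by_contra! hcon
      have := le_csSup hL ⟨s', δ', hδ', hcon⟩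
      linarith
    obtain ⟨f, hf, hFf⟩ := hlow s δ hδ
    refine ⟨T f, ContinuousLinearMap.opNorm_le_bound _ hη.le fun φ => ?_⟩
    refine le_of_forall_pos_le_add fun ρ hρ => ?_
    classical
    obtain ⟨g, hg, hFg⟩ := hlow (insert φ s) (min δ ρ) (lt_min hδ hρ)
    have hg' : g ∈ N s δ :=
      ⟨hg.1, fun ψ hψ => (hg.2 ψ (Finset.mem_insert_of_mem hψ)).trans_le (min_le_left _ _)⟩
    have h1 := hc _ (hNmid s δ f hf g hg')
    have h2 := h f hf.1 g hg.1 (by linarith)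
    have h3 := (hg.2 φ (Finset.mem_insert_self _ _)).trans_le (min_le_right _ _)
    have h4 : ‖φ (T (f - g))‖ ≤ η * ‖φ‖ := by
      refine (φ.le_opNorm _).trans ?_
      rw [mul_comm]
      gcongr
    calc ‖(NormedSpace.inclusionInDoubleDual ℂ Y (T f) - WeakDual.toStrongDual x) φ‖
        = ‖φ (T (f - g)) + (φ (T g) - x φ)‖ := by
          congr 1
          simp only [map_sub]
          change φ (T f) - x φ = _
          ring
      _ ≤ η * ‖φ‖ + ρ := (norm_add_le _ _).trans (by linarith)
  have hiso : Isometry (NormedSpace.inclusionInDoubleDual ℂ Y) :=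
    (NormedSpace.inclusionInDoubleDualLi (E := Y) ℂ).isometry
  have hclosed := hiso.isClosedEmbedding.isClosed_range
  have hmem : WeakDual.toStrongDual x ∈ range (NormedSpace.inclusionInDoubleDual ℂ Y) := by
    rw [← hclosed.closure_eq, Metric.mem_closure_iff]
    intro ε hε
    obtain ⟨y, hy⟩ := happrox (ε / 2) (by linarith)
    refine ⟨_, ⟨y, rfl⟩, ?_⟩
    rw [dist_comm, dist_eq_norm]
    linarith
  obtain ⟨y, hy⟩ := hmem
  exact ⟨toWeakSpace ℂ Y y, congrArg StrongDual.toWeakDual hy⟩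

theorem isWeaklyCompactOp_of_modular_bound {Ω : Type*} [MeasurableSpace Ω] {μ : Measure Ω}
    [IsProbabilityMeasure μ] {Ψ : ℝ → ℝ} (hΨ : IsOrliczFunction Ψ)
    (hΦ : Delta2 (complementaryOrlicz Ψ)) {X : Submodule ℂ (Ω → ℂ)}
    (hXM : ∀ f ∈ X, MemMorseTransue Ψ μ f)
    {Y : Type*} [NormedAddCommGroup Y] [NormedSpace ℂ Y] [CompleteSpace Y]
    {T : X →ₗ[ℂ] Y} (hT : ∃ M : ℝ, ∀ f : X, ‖T f‖ ≤ M * luxNorm Ψ μ (f : Ω → ℂ))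
    (h : ∀ ε > 0, ∃ C > 0, ∀ f : X, luxNorm Ψ μ (f : Ω → ℂ) ≠ 0 →
        ‖T f‖ ≤ (C * (orliczModular Ψ μ (f : Ω → ℂ)
              (luxNorm Ψ μ (f : Ω → ℂ) / ε)).toReal + ε) * luxNorm Ψ μ (f : Ω → ℂ)) :
    IsWeaklyCompactOp Ψ μ T := by
  obtain ⟨M, hM, hTM⟩ : ∃ M > 0, ∀ f : X, ‖T f‖ ≤ M * luxNorm Ψ μ (f : Ω → ℂ) := by
    obtain ⟨M, hM⟩ := hT
    refine ⟨max M 1, by positivity, fun f => (hM f).trans ?_⟩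
    exact mul_le_mul_of_nonneg_right (le_max_left _ _) luxNorm_nonneg
  obtain ⟨G, hGm, hG0, ⟨A, hA, hGA⟩, hG⟩ := hΨ.exists_convexity_defect hΦ
  have hmem : ∀ f : X, MemMorseTransue Ψ μ (f : Ω → ℂ) := fun f => hXM f f.2
  have h_int : ∀ f : X, ∀ c : ℝ, 0 ≤ c → Integrable (fun ω => Ψ (c * ‖(f : Ω → ℂ) ω‖)) μ :=
    fun f c hc => (hmem f).integrable hΨ hc
  let B : Set X := {f | ∫ ω, Ψ (1 / 2 * ‖(f : Ω → ℂ) ω‖) ∂μ ≤ 1}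
  have hball : luxUnitBall Ψ μ X ⊆ B := fun f hf =>
    (hmem f).integral_le_one hΨ (by norm_num) (lt_of_le_of_lt hf (by norm_num))
  have hmid : ∀ f g d : X, (∀ ω, ‖(d : Ω → ℂ) ω‖ ≤ ‖(f : Ω → ℂ) ω‖ + ‖(g : Ω → ℂ) ω‖) →
      f ∈ B → g ∈ B → ∫ ω, Ψ (1 / 4 * ‖(d : Ω → ℂ) ω‖) ∂μ ≤ 1 := by
    intro f g d hd hf hg
    have hif := h_int f (1 / 2) (by norm_num)
    have hig := h_int g (1 / 2) (by norm_num)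
    calc ∫ ω, Ψ (1 / 4 * ‖(d : Ω → ℂ) ω‖) ∂μ
        ≤ ∫ ω, (Ψ (1 / 2 * ‖(f : Ω → ℂ) ω‖) + Ψ (1 / 2 * ‖(g : Ω → ℂ) ω‖)) / 2 ∂μ := by
          refine integral_mono (h_int d _ (by norm_num)) ((hif.add hig).div_const 2) fun ω => ?_
          refine le_trans (hΨ.mono (mem_Ici.2 (by positivity)) (mem_Ici.2 (by positivity)) ?_)
            (hΨ.map_half_add_le (by positivity) (by positivity))
          linarith [hd ω]
      _ = (∫ ω, Ψ (1 / 2 * ‖(f : Ω → ℂ) ω‖) ∂μ + ∫ ω, Ψ (1 / 2 * ‖(g : Ω → ℂ) ω‖) ∂μ) / 2 := by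
          rw [integral_div, integral_add hif hig]
      _ ≤ 1 := by
          have h1 : _ ≤ (1 : ℝ) := hf
          have h2 : _ ≤ (1 : ℝ) := hg
          linarith
  have hGint : ∀ f : X, Integrable (fun ω => G (1 / 2 * ‖(f : Ω → ℂ) ω‖)) μ := by
    intro f
    refine (((h_int f (1 / 2) (by norm_num)).add (integrable_const 1)).const_mul A).mono' ?_
      (Eventually.of_forall fun ω => ?_)
    · exact (hGm.comp_aemeasurable
        ((hmem f).1.norm.aemeasurable.const_mul (1 / 2))).aestronglyMeasurable
    · rw [Real.norm_of_nonneg (hG0 _)]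
      exact hGA _ (by positivity)
  have hBT : RelWeaklyCompact (T '' B) := by
    refine relWeaklyCompact_image_of_convexity_defect T (B := B) ?_ (M := M * 2) ?_
      (F := fun f => ∫ ω, G (1 / 2 * ‖(f : Ω → ℂ) ω‖) ∂μ)
      (fun f _ => integral_nonneg fun ω => hG0 _) (b := A * (1 + 1)) ?_ ?_
    · intro f hf g hg
      have h1 := hmid f g (f + g) (fun ω => norm_add_le _ _) hf hg
      refine le_of_eq_of_le (integral_congr_ae (Eventually.of_forall fun ω => ?_)) h1
      simp only [Submodule.coe_smul, Pi.smul_apply, norm_smul]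
      norm_num
      ring_nf
    · intro f hf
      refine (hTM f).trans (mul_le_mul_of_nonneg_left ?_ hM.le)
      exact ((hmem f).luxNorm_le hΨ (by norm_num) hf).trans (by norm_num)
    · intro f hf
      have hif := h_int f (1 / 2) (by norm_num)
      calc ∫ ω, G (1 / 2 * ‖(f : Ω → ℂ) ω‖) ∂μ
          ≤ ∫ ω, A * (Ψ (1 / 2 * ‖(f : Ω → ℂ) ω‖) + 1) ∂μ :=
            integral_mono (hGint f) ((hif.add (integrable_const 1)).const_mul A)
              fun ω => hGA _ (by positivity)
        _ = A * (∫ ω, Ψ (1 / 2 * ‖(f : Ω → ℂ) ω‖) ∂μ + 1) := by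
            rw [integral_const_mul, integral_add hif (integrable_const 1)]
            simp
        _ ≤ A * (1 + 1) := by
            gcongr
            exact hf
    intro η hη
    set δ := η / M with hδ
    have hδ0 : 0 < δ := by positivity
    set ε := min (δ / 8) (η / 8) with hε
    have hε0 : 0 < ε := by positivity
    obtain ⟨K, hK, hTK⟩ := h ε hε0
    obtain ⟨C, hC, hGC⟩ := hG (η / (48 * K)) (by positivity)
    refine ⟨η / (16 * K * C), by positivity, fun f hf g hg hD => ?_⟩
    have hd4 := hmid f g (f - g) (fun ω => norm_sub_le _ _) hf hg
    set d := f - g with hd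
    set t := luxNorm Ψ μ (d : Ω → ℂ) with ht
    have ht4 : t ≤ 4 := ((hmem d).luxNorm_le hΨ (by norm_num) hd4).trans (by norm_num)
    rcases le_or_gt t δ with htδ | htδ
    · refine (hTM d).trans ?_
      rw [hδ, le_div_iff₀ hM] at htδ
      linarith
    have ht0 : 0 < t := hδ0.trans htδ
    have hmod : ∫ ω, Ψ (1 / 8 * ‖(d : Ω → ℂ) ω‖) ∂μ ≤ η / (8 * K) := by
      have hif := h_int f (1 / 2) (by norm_num)
      have hig := h_int g (1 / 2) (by norm_num)
      have hGf := hGint f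
      have hGg := hGint g
      have hGa := hGint ((1 / 2 : ℂ) • (f + g))
      have e0 : Integrable (fun ω => (G (1 / 2 * ‖(f : Ω → ℂ) ω‖) +
          G (1 / 2 * ‖(g : Ω → ℂ) ω‖)) / 2) μ := (hGf.add hGg).div_const 2
      have e1 : Integrable (fun ω => C * ((G (1 / 2 * ‖(f : Ω → ℂ) ω‖) +
          G (1 / 2 * ‖(g : Ω → ℂ) ω‖)) / 2 -
            G (1 / 2 * ‖(((1 / 2 : ℂ) • (f + g) : X) : Ω → ℂ) ω‖))) μ :=
        (e0.sub hGa).const_mul C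
      have e2 : Integrable (fun ω => 1 + Ψ (1 / 2 * ‖(f : Ω → ℂ) ω‖)) μ :=
        (integrable_const 1).add hif
      have e3 : Integrable (fun ω => η / (48 * K) * (1 + Ψ (1 / 2 * ‖(f : Ω → ℂ) ω‖) +
          Ψ (1 / 2 * ‖(g : Ω → ℂ) ω‖))) μ := (e2.add hig).const_mul _
      have h1 := integral_mono (h_int d (1 / 8) (by norm_num)) (e1.add e3) fun ω => by
        have := hGC (1 / 2 * (f : Ω → ℂ) ω) (1 / 2 * (g : Ω → ℂ) ω)
        rw [← mul_sub, ← mul_add] at this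
        simp only [norm_mul, norm_div, norm_one, Complex.norm_ofNat] at this
        simp only [Pi.add_apply, Pi.sub_apply, Submodule.coe_smul, Submodule.coe_add,
          Pi.smul_apply, norm_smul, hd, Submodule.coe_sub, norm_div, norm_one,
          Complex.norm_ofNat]
        rw [show 1 / 8 * ‖(f : Ω → ℂ) ω - (g : Ω → ℂ) ω‖ =
            1 / 2 * ‖(f : Ω → ℂ) ω - (g : Ω → ℂ) ω‖ / 4 by ring,
          show 1 / 2 * (1 / 2 * ‖(f : Ω → ℂ) ω + (g : Ω → ℂ) ω‖) =
            1 / 2 * ‖(f : Ω → ℂ) ω + (g : Ω → ℂ) ω‖ / 2 by ring]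
        exact this
      rw [integral_add' e1 e3, integral_const_mul, integral_const_mul, integral_sub e0 hGa,
        integral_div, integral_add hGf hGg, integral_add e2 hig,
        integral_add (integrable_const 1) hif, integral_const] at h1
      simp only [probReal_univ, smul_eq_mul, mul_one] at h1
      refine h1.trans ?_
      have h2 : _ ≤ (1 : ℝ) := hf
      have h3 : _ ≤ (1 : ℝ) := hg
      calc _ ≤ C * (η / (16 * K * C)) + η / (48 * K) * (1 + 1 + 1) :=
            add_le_add (mul_le_mul_of_nonneg_left hD hC.le)
              (mul_le_mul_of_nonneg_left (by linarith) (by positivity))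
        _ = η / (8 * K) := by
            field_simp
            ring
    have hmod' : (orliczModular Ψ μ (d : Ω → ℂ) (t / ε)).toReal ≤ η / (8 * K) := by
      have hεt : 0 ≤ ε / t := by positivity
      rw [← inv_div, (hmem d).orliczModular_eq hΨ hεt,
        ENNReal.toReal_ofReal (integral_nonneg fun ω => hΨ.nonneg _)]
      refine le_trans (integral_mono (h_int d _ hεt) (h_int d _ (by norm_num)) fun ω => ?_) hmod
      refine hΨ.mono (mem_Ici.2 (by positivity)) (mem_Ici.2 (by positivity)) ?_
      refine mul_le_mul_of_nonneg_right ?_ (norm_nonneg _)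
      rw [div_le_iff₀ ht0]
      have : ε ≤ δ / 8 := min_le_left _ _
      linarith
    have h1 := hTK d ht0.ne'
    rw [← ht] at h1
    have h2 : K * (orliczModular Ψ μ (d : Ω → ℂ) (t / ε)).toReal ≤ η / 8 := by
      rw [le_div_iff₀ (by positivity)] at hmod'
      linarith
    have h3 : ε ≤ η / 8 := min_le_right _ _
    nlinarith
  obtain ⟨K, hK, hsub⟩ := hBT
  exact ⟨K, hK, (image_mono (image_mono hball)).trans hsub⟩

/-- A series all of whose bounded-coefficient partial sums lie in a weakly compact set has terms
that are not bounded away from zero. -/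
theorem exists_norm_le_of_forall_sum_mem_isCompact {Y : Type*} [NormedAddCommGroup Y]
    [NormedSpace ℂ Y] {y : ℕ → Y} {K : Set (WeakSpace ℂ Y)} (hK : IsCompact K)
    (hy : ∀ c : ℕ → ℂ, (∀ k, ‖c k‖ ≤ 1) → ∀ N,
      toWeakSpace ℂ Y (∑ k ∈ Finset.range N, c k • y k) ∈ K) {ε : ℝ} (hε : 0 < ε) :
    ∃ k, ‖y k‖ ≤ ε := by
  have hcont : ∀ φ : StrongDual ℂ Y, Continuous fun z : WeakSpace ℂ Y => φ z := fun φ =>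
    WeakBilin.eval_continuous (topDualPairing ℂ Y).flip φ
  have hsum : ∀ φ : StrongDual ℂ Y, Summable fun k => ‖φ (y k)‖ := by
    intro φ
    obtain ⟨b, hb⟩ := (hK.image (hcont φ)).isBounded.exists_norm_le
    refine summable_of_sum_range_le (c := b) (fun k => norm_nonneg _) fun N => ?_
    have h1 := hy (fun k => (‖φ (y k)‖ : ℂ) / φ (y k))
      (fun k => by
        rw [norm_div, Complex.norm_real, norm_norm]
        exact div_self_le_one _) N
    have h2 := hb _ ⟨_, h1, rfl⟩
    have h3 : φ (∑ k ∈ Finset.range N, ((‖φ (y k)‖ : ℂ) / φ (y k)) • y k) =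
        ((∑ k ∈ Finset.range N, ‖φ (y k)‖ : ℝ) : ℂ) := by
      rw [map_sum, Complex.ofReal_sum]
      refine Finset.sum_congr rfl fun k _ => ?_
      rw [map_smul, smul_eq_mul]
      refine div_mul_cancel_of_imp fun h => ?_
      simp [h]
    change ‖φ (∑ k ∈ Finset.range N, ((‖φ (y k)‖ : ℂ) / φ (y k)) • y k)‖ ≤ b at h2
    rw [h3, Complex.norm_real] at h2
    exact (le_abs_self _).trans h2
  let a : (ℕ → Bool) → ℕ → ℂ := fun c k => if c k then 1 else 0
  have ha : ∀ c k, ‖a c k‖ ≤ 1 := fun c k => by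
    simp only [a]
    split_ifs <;> simp
  have hterm : ∀ (φ : StrongDual ℂ Y) c k, ‖a c k * φ (y k)‖ ≤ ‖φ (y k)‖ := fun φ c k => by
    rw [norm_mul]
    exact mul_le_of_le_one_left (norm_nonneg _) (ha c k)
  have hsum' : ∀ (φ : StrongDual ℂ Y) c, Summable fun k => a c k * φ (y k) := fun φ c =>
    Summable.of_norm_bounded (hsum φ) (hterm φ c)
  let E : Set Y := Submodule.span ℂ (range y)
  have hs : ∀ c : ℕ → Bool, ∃ s ∈ closure E,
      ∀ φ : StrongDual ℂ Y, φ s = ∑' k, a c k * φ (y k) := by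
    intro c
    obtain ⟨s, -, hs⟩ := hK.exists_mapClusterPt_of_frequently (l := atTop)
      (f := fun N => toWeakSpace ℂ Y (∑ k ∈ Finset.range N, a c k • y k))
      (Eventually.of_forall fun N => hy (a c) (ha c) N).frequently
    refine ⟨(toWeakSpace ℂ Y).symm s, ?_, fun φ => ?_⟩
    · have hE : Convex ℝ E := ((Submodule.span ℂ (range y)).restrictScalars ℝ).convex
      have h1 : s ∈ closure (toWeakSpace ℂ Y '' E) := by
        rw [mem_closure_iff_clusterPt]
        refine hs.clusterPt.mono (le_principal_iff.2 (eventually_map.2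
          (Eventually.of_forall fun N => mem_image_of_mem _ ?_)))
        exact Submodule.sum_mem _ fun k _ => Submodule.smul_mem _ _
          (Submodule.subset_span ⟨k, rfl⟩)
      rw [← hE.toWeakSpace_closure ℂ] at h1
      obtain ⟨z, hz, rfl⟩ := h1
      simpa using hz
    · have h1 := hs.tendsto_comp ((hcont φ).tendsto s)
      have h2 := (hsum' φ c).hasSum.tendsto_sum_nat
      have h3 : (fun z : WeakSpace ℂ Y => φ z) ∘
          (fun N => toWeakSpace ℂ Y (∑ k ∈ Finset.range N, a c k • y k)) =
          fun N => ∑ k ∈ Finset.range N, a c k * φ (y k) := by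
        funext N
        change φ (∑ k ∈ Finset.range N, a c k • y k) = _
        simp [map_sum]
      rw [h3] at h1
      exact eq_of_nhds_neBot (h1.clusterPt.mono h2).neBot
  choose s hsE hs using hs
  obtain ⟨D, hDc, hD⟩ : TopologicalSpace.IsSeparable (closure E) :=
    ((countable_range y).isSeparable.span (R := ℂ)).closure
  have : Countable D := hDc.to_subtype
  let F : D → Set (ℕ → Bool) := fun d =>
    ⋂ φ : StrongDual ℂ Y, {c | ‖∑' k, a c k * φ (y k) - φ d‖ ≤ ε / 2 * ‖φ‖}
  have hFclosed : ∀ d, IsClosed (F d) := by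
    refine fun d => isClosed_iInter fun φ => isClosed_le ?_ continuous_const
    refine ((continuous_tsum (fun k => ?_) (hsum φ) fun k c => hterm φ c k).sub
      continuous_const).norm
    exact (((continuous_of_discreteTopology (f := fun b : Bool => if b then (1 : ℂ) else 0)).comp
      (continuous_apply k))).mul continuous_const
  have hFcover : ⋃ d, F d = univ := by
    refine eq_univ_of_forall fun c => mem_iUnion.2 ?_
    obtain ⟨d, hd, hcd⟩ := Metric.mem_closure_iff.1 (hD (hsE c)) (ε / 2) (by linarith)
    refine ⟨⟨d, hd⟩, mem_iInter.2 fun φ => ?_⟩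
    rw [Set.mem_ofPred_eq, ← hs, ← map_sub, mul_comm]
    refine (φ.le_opNorm _).trans (mul_le_mul_of_nonneg_left ?_ (norm_nonneg _))
    rw [← dist_eq_norm]
    exact hcd.le
  obtain ⟨d, c, hc⟩ := nonempty_interior_of_iUnion_of_closed hFclosed hFcover
  have hupd : ∀ b, Tendsto (fun k => Function.update c k b) atTop (𝓝 c) := by
    refine fun b => tendsto_pi_nhds.2 fun j => tendsto_const_nhds.congr' ?_
    filter_upwards [eventually_gt_atTop j] with k hk
    rw [Function.update_of_ne hk.ne]
  have hmem := mem_interior_iff_mem_nhds.1 hc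
  obtain ⟨k, hk1, hk0⟩ := (((hupd true).eventually_mem hmem).and
    ((hupd false).eventually_mem hmem)).exists
  refine ⟨k, NormedSpace.norm_le_dual_bound ℂ _ hε.le fun φ => ?_⟩
  have h1 := mem_iInter.1 hk1 φ
  have h0 := mem_iInter.1 hk0 φ
  rw [Set.mem_ofPred_eq] at h1 h0
  have hdiff : φ (y k) = (∑' j, a (Function.update c k true) j * φ (y j) - φ d) -
      (∑' j, a (Function.update c k false) j * φ (y j) - φ d) := by
    rw [sub_sub_sub_cancel_right, ← (hsum' φ _).tsum_sub (hsum' φ _), tsum_eq_single k]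
    · simp [a]
    · intro j hj
      simp [a, Function.update_of_ne hj]
  rw [hdiff]
  refine (norm_sub_le _ _).trans ?_
  linarith

theorem IsOrliczFunction.map_half_sum_le {Ψ : ℝ → ℝ} (hΨ : IsOrliczFunction Ψ) {ε : ℝ}
    (hε : 0 ≤ ε) {x : ℕ → ℝ} (hx : ∀ k, 0 ≤ x k) (N : ℕ) :
    Ψ (ε / 2 * ∑ k ∈ Finset.range N, x k) ≤
      (∑ k ∈ Finset.range N, Ψ (ε * x k) + ∑ k ∈ Finset.range N, (1 / 2) ^ (k + 1) *
        Ψ (2 ^ (k + 1) * ε * min (∑ j ∈ Finset.range k, x j) (x k))) / 2 := by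
  set S : ℕ → ℝ := fun k => ∑ j ∈ Finset.range k, x j with hS
  have hS0 : ∀ k, 0 ≤ S k := fun k => Finset.sum_nonneg fun j _ => hx j
  set m : ℕ → ℝ := fun k => min (S k) (x k) with hm
  have hm0 : ∀ k, 0 ≤ m k := fun k => le_min (hS0 k) (hx k)
  have hmax : ∀ N, ∃ b, 0 ≤ b ∧ Ψ (ε * b) ≤ ∑ k ∈ Finset.range N, Ψ (ε * x k) ∧
      S N ≤ b + ∑ k ∈ Finset.range N, m k := by
    intro N
    induction N with
    | zero => exact ⟨0, le_rfl, by simp [hΨ.map_zero], by simp [hS]⟩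
    | succ N ih =>
      obtain ⟨b, hb, hb1, hb2⟩ := ih
      refine ⟨max b (x N), hb.trans (le_max_left _ _), ?_, ?_⟩
      · rw [Finset.sum_range_succ]
        have h1 := hΨ.nonneg (ε * x N)
        have h2 : 0 ≤ ∑ k ∈ Finset.range N, Ψ (ε * x k) :=
          Finset.sum_nonneg fun k _ => hΨ.nonneg _
        rcases max_choice b (x N) with h | h <;> rw [h] <;> linarith
      · have h1 : S (N + 1) = S N + x N := Finset.sum_range_succ _ _
        have h2 : m N + max (S N) (x N) = S N + x N := min_add_max _ _
        have h3 : 0 ≤ ∑ k ∈ Finset.range N, m k := Finset.sum_nonneg fun k _ => hm0 k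
        rw [h1, Finset.sum_range_succ]
        have h4 : max (S N) (x N) ≤ max b (x N) + ∑ k ∈ Finset.range N, m k :=
          max_le (by linarith [le_max_left b (x N)]) (by linarith [le_max_right b (x N)])
        linarith
  obtain ⟨b, hb, hb1, hb2⟩ := hmax N
  have hgeom : ∀ N, (1 / 2 : ℝ) ^ N + ∑ k ∈ Finset.range N, (1 / 2 : ℝ) ^ (k + 1) = 1 := by
    intro N
    induction N with
    | zero => simp
    | succ N ih =>
      rw [Finset.sum_range_succ, pow_succ]
      linarith
  have h1 := hΨ.strictConvexOn.convexOn.map_add_sum_le (t := Finset.range N) (q := 0)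
    (p := fun k => 2 ^ (k + 1) * ε * m k) (fun k _ => by positivity) (hgeom N)
    (fun k _ => mem_Ici.2 (by have := hm0 k; positivity)) (by positivity) (mem_Ici.2 le_rfl)
  simp only [smul_eq_mul, mul_zero, hΨ.map_zero, zero_add] at h1
  have h2 : ∑ k ∈ Finset.range N, (1 / 2 : ℝ) ^ (k + 1) * (2 ^ (k + 1) * ε * m k) =
      ε * ∑ k ∈ Finset.range N, m k := by
    rw [Finset.mul_sum]
    refine Finset.sum_congr rfl fun k _ => ?_
    rw [mul_assoc, ← mul_assoc, ← mul_pow]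
    norm_num
  rw [h2] at h1
  have hm1 : 0 ≤ ∑ k ∈ Finset.range N, m k := Finset.sum_nonneg fun k _ => hm0 k
  have h3 := hΨ.map_half_add_le (x := ε * b) (y := ε * ∑ k ∈ Finset.range N, m k)
    (by positivity) (by positivity)
  have h4 : Ψ (ε / 2 * S N) ≤ Ψ ((ε * b + ε * ∑ k ∈ Finset.range N, m k) / 2) := by
    refine hΨ.mono (mem_Ici.2 (mul_nonneg (by positivity) (hS0 N)))
      (mem_Ici.2 (by positivity)) ?_
    have := mul_le_mul_of_nonneg_left hb2 hε
    linarith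
  linarith

section Selection

variable {Ω : Type*} [MeasurableSpace Ω] {μ : Measure Ω} {Ψ : ℝ → ℝ}

theorem IsOrliczFunction.ae_tendsto_zero (hΨ : IsOrliczFunction Ψ) {x : ℕ → Ω → ℝ}
    (hx0 : ∀ n ω, 0 ≤ x n ω) {ε : ℝ} (hε : 0 < ε)
    (h_int : ∀ n, Integrable (fun ω => Ψ (ε * x n ω)) μ)
    (h : ∀ n, ∫ ω, Ψ (ε * x n ω) ∂μ ≤ (1 / 2) ^ n) :
    ∀ᵐ ω ∂μ, Tendsto (fun n => x n ω) atTop (𝓝 0) := by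
  have hsum : ∑' n, ∫⁻ ω, ENNReal.ofReal (Ψ (ε * x n ω)) ∂μ ≠ ∞ := by
    refine ne_top_of_le_ne_top (ENNReal.ofReal_ne_top (r := ∑' n : ℕ, (1 / 2 : ℝ) ^ n)) ?_
    rw [ENNReal.ofReal_tsum_of_nonneg (fun n => by positivity) summable_geometric_two]
    refine ENNReal.tsum_le_tsum fun n => ?_
    rw [← ofReal_integral_eq_lintegral_ofReal (h_int n) (Eventually.of_forall fun ω => hΨ.nonneg _)]
    exact ENNReal.ofReal_le_ofReal (h n)
  have hmeas : ∀ n, AEMeasurable (fun ω => ENNReal.ofReal (Ψ (ε * x n ω))) μ := fun n =>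
    (h_int n).aemeasurable.ennreal_ofReal
  rw [← lintegral_tsum hmeas] at hsum
  filter_upwards [ae_lt_top' (AEMeasurable.tsum hmeas) hsum] with ω hω
  have h0 := ENNReal.tendsto_atTop_zero_of_tsum_ne_top hω.ne
  refine (tendsto_order.2 ⟨fun a ha => Eventually.of_forall fun n => ha.trans_le (hx0 n ω),
    fun a ha => ?_⟩)
  have hpos := hΨ.pos (mul_pos hε ha)
  filter_upwards [h0.eventually_lt_const (ENNReal.ofReal_pos.2 hpos)] with n hn
  by_contra! hcon
  refine hn.not_ge (ENNReal.ofReal_le_ofReal (hΨ.mono ?_ ?_ ?_))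
  · exact mem_Ici.2 (by positivity)
  · exact mem_Ici.2 (mul_nonneg hε.le (hx0 n ω))
  · gcongr

theorem IsOrliczFunction.tendsto_integral_min (hΨ : IsOrliczFunction Ψ) {x : ℕ → Ω → ℝ}
    (hx : ∀ n, AEMeasurable (x n) μ) (hx0 : ∀ n ω, 0 ≤ x n ω)
    (hlim : ∀ᵐ ω ∂μ, Tendsto (fun n => x n ω) atTop (𝓝 0)) {S : Ω → ℝ} (hS : AEMeasurable S μ)
    (hS0 : ∀ ω, 0 ≤ S ω) {R : ℝ} (hR : 0 ≤ R) (h_int : Integrable (fun ω => Ψ (R * S ω)) μ) :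
    Tendsto (fun n => ∫ ω, Ψ (R * min (S ω) (x n ω)) ∂μ) atTop (𝓝 0) := by
  have hmin0 : ∀ n ω, 0 ≤ min (S ω) (x n ω) := fun n ω => le_min (hS0 ω) (hx0 n ω)
  rw [show (0 : ℝ) = ∫ _, (0 : ℝ) ∂μ by simp]
  refine tendsto_integral_of_dominated_convergence (fun ω => Ψ (R * S ω)) (fun n => ?_) h_int
    (fun n => Eventually.of_forall fun ω => ?_) ?_
  · exact hΨ.aestronglyMeasurable_comp ((hS.min (hx n)).const_mul R)
      fun ω => mul_nonneg hR (hmin0 n ω)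
  · rw [Real.norm_of_nonneg (hΨ.nonneg _)]
    exact hΨ.mono (mem_Ici.2 (mul_nonneg hR (hmin0 n ω))) (mem_Ici.2 (mul_nonneg hR (hS0 ω)))
      (mul_le_mul_of_nonneg_left (min_le_left _ _) hR)
  · filter_upwards [hlim] with ω hω
    have h1 : Tendsto (fun n => R * min (S ω) (x n ω)) atTop (𝓝[Ici 0] 0) := by
      refine tendsto_nhdsWithin_iff.2 ⟨?_, Eventually.of_forall fun n =>
        mem_Ici.2 (mul_nonneg hR (hmin0 n ω))⟩
      have := (tendsto_const_nhds (x := S ω)).min hω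
      rw [min_eq_right (hS0 ω)] at this
      simpa using this.const_mul R
    have h2 := hΨ.continuousWithinAt_zero.tendsto.comp h1
    rwa [hΨ.map_zero] at h2

/-- A sequence whose modulars are summable has a subsequence all of whose partial sums of absolute
values are bounded in the Orlicz space. -/
theorem IsOrliczFunction.exists_subseq_integral_sum_le (hΨ : IsOrliczFunction Ψ)
    {u : ℕ → Ω → ℂ} (hu : ∀ n, MemMorseTransue Ψ μ (u n)) {ε : ℝ} (hε : 0 < ε)
    (h : ∀ n, ∫ ω, Ψ (ε * ‖u n ω‖) ∂μ ≤ (1 / 2) ^ n) :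
    ∃ σ : ℕ → ℕ, ∀ N,
      Integrable (fun ω => Ψ (ε / 2 * ∑ k ∈ Finset.range N, ‖u (σ k) ω‖)) μ ∧
        ∫ ω, Ψ (ε / 2 * ∑ k ∈ Finset.range N, ‖u (σ k) ω‖) ∂μ ≤ 1 := by
  have hx : ∀ n, AEMeasurable (fun ω => ‖u n ω‖) μ := fun n => (hu n).1.norm.aemeasurable
  have hx0 : ∀ n ω, 0 ≤ ‖u n ω‖ := fun n ω => norm_nonneg _
  have hlim := hΨ.ae_tendsto_zero hx0 hε (fun n => (hu n).integrable hΨ hε.le) h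
  let good : Set (Ω → ℝ) := {S | AEMeasurable S μ ∧ (∀ ω, 0 ≤ S ω) ∧
    ∀ R : ℝ, 0 ≤ R → Integrable (fun ω => Ψ (R * S ω)) μ}
  have hgood0 : (fun _ => 0) ∈ good :=
    ⟨aemeasurable_const, fun _ => le_rfl, fun R _ => by simp [hΨ.map_zero]⟩
  have hgood_add : ∀ S ∈ good, ∀ n, (fun ω => S ω + ‖u n ω‖) ∈ good := by
    rintro S ⟨hS, hS0, hSint⟩ n
    refine ⟨hS.add (hx n), fun ω => add_nonneg (hS0 ω) (hx0 n ω), fun R hR => ?_⟩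
    have h2R : 0 ≤ 2 * R := by positivity
    refine (((hSint _ h2R).add ((hu n).integrable hΨ h2R)).div_const 2).mono'
      (hΨ.aestronglyMeasurable_comp ((hS.add (hx n)).const_mul R)
        fun ω => mul_nonneg hR (add_nonneg (hS0 ω) (hx0 n ω))) (Eventually.of_forall fun ω => ?_)
    rw [Real.norm_of_nonneg (hΨ.nonneg _)]
    have := hΨ.map_half_add_le (mul_nonneg h2R (hS0 ω)) (mul_nonneg h2R (hx0 n ω))
    rwa [show (2 * R * S ω + 2 * R * ‖u n ω‖) / 2 = R * (S ω + ‖u n ω‖) by ring] at this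
  have hstep : ∀ (k : ℕ) (S : good), ∃ n, ∫ ω, Ψ (ε * ‖u n ω‖) ∂μ ≤ (1 / 2) ^ (k + 1) ∧
      ∫ ω, Ψ (2 ^ (k + 1) * ε * min (S.1 ω) ‖u n ω‖) ∂μ ≤ 1 := by
    rintro k ⟨S, hS, hS0, hSint⟩
    have hR : 0 ≤ 2 ^ (k + 1) * ε := by positivity
    have h1 := hΨ.tendsto_integral_min hx hx0 hlim hS hS0 hR (hSint _ hR)
    obtain ⟨n, hn, hnk⟩ := ((h1.eventually_lt_const one_pos).and
      (eventually_ge_atTop (k + 1))).exists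
    exact ⟨n, (h n).trans (pow_le_pow_of_le_one (by norm_num) (by norm_num) hnk), hn.le⟩
  choose next hnext1 hnext2 using hstep
  let S : ℕ → good := fun k => Nat.rec (motive := fun _ => good) ⟨_, hgood0⟩
    (fun k S => ⟨_, hgood_add S.1 S.2 (next k S)⟩) k
  let σ : ℕ → ℕ := fun k => next k (S k)
  have hSsum : ∀ k ω, (S k).1 ω = ∑ j ∈ Finset.range k, ‖u (σ j) ω‖ := by
    intro k ω
    induction k with
    | zero => rfl
    | succ k ih => rw [Finset.sum_range_succ, ← ih]
  refine ⟨σ, fun N => ⟨by simpa only [hSsum] using (S N).2.2.2 (ε / 2) (by positivity), ?_⟩⟩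
  have hi1 : ∀ k ∈ Finset.range N, Integrable (fun ω => Ψ (ε * ‖u (σ k) ω‖)) μ :=
    fun k _ => (hu _).integrable hΨ hε.le
  have hi2 : ∀ k ∈ Finset.range N, Integrable (fun ω => (1 / 2) ^ (k + 1) *
      Ψ (2 ^ (k + 1) * ε * min (∑ j ∈ Finset.range k, ‖u (σ j) ω‖) ‖u (σ k) ω‖)) μ := by
    intro k _
    have hR : 0 ≤ 2 ^ (k + 1) * ε := by positivity
    have hm0 : ∀ ω, 0 ≤ min (∑ j ∈ Finset.range k, ‖u (σ j) ω‖) ‖u (σ k) ω‖ := fun ω =>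
      le_min (Finset.sum_nonneg fun j _ => norm_nonneg _) (norm_nonneg _)
    refine (((hu (σ k)).integrable hΨ hR).mono' (hΨ.aestronglyMeasurable_comp
      (((Finset.aemeasurable_fun_sum _ fun j _ => hx (σ j)).min (hx _)).const_mul _)
        fun ω => mul_nonneg hR (hm0 ω)) (Eventually.of_forall fun ω => ?_)).const_mul _
    rw [Real.norm_of_nonneg (hΨ.nonneg _)]
    exact hΨ.mono (mem_Ici.2 (mul_nonneg hR (hm0 ω))) (mem_Ici.2 (by positivity))
      (mul_le_mul_of_nonneg_left (min_le_right _ _) hR)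
  have hgeom : ∀ N, ∑ k ∈ Finset.range N, (1 / 2 : ℝ) ^ (k + 1) ≤ 1 := fun N => by
    simp_rw [pow_succ, ← Finset.sum_mul]
    linarith [sum_geometric_two_le N]
  have hi12 := ((integrable_finsetSum _ hi1).add (integrable_finsetSum _ hi2)).div_const 2
  calc ∫ ω, Ψ (ε / 2 * ∑ k ∈ Finset.range N, ‖u (σ k) ω‖) ∂μ
      ≤ ∫ ω, (∑ k ∈ Finset.range N, Ψ (ε * ‖u (σ k) ω‖) +
          ∑ k ∈ Finset.range N, (1 / 2) ^ (k + 1) * Ψ (2 ^ (k + 1) * ε *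
            min (∑ j ∈ Finset.range k, ‖u (σ j) ω‖) ‖u (σ k) ω‖)) / 2 ∂μ :=
        integral_mono_of_nonneg (Eventually.of_forall fun ω => hΨ.nonneg _) hi12
          (Eventually.of_forall fun ω => hΨ.map_half_sum_le hε.le (fun k => hx0 (σ k) ω) N)
    _ = (∑ k ∈ Finset.range N, ∫ ω, Ψ (ε * ‖u (σ k) ω‖) ∂μ +
          ∑ k ∈ Finset.range N, (1 / 2) ^ (k + 1) * ∫ ω, Ψ (2 ^ (k + 1) * ε *
            min (∑ j ∈ Finset.range k, ‖u (σ j) ω‖) ‖u (σ k) ω‖) ∂μ) / 2 := by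
        rw [integral_div, integral_add (integrable_finsetSum _ hi1) (integrable_finsetSum _ hi2),
          integral_finsetSum _ hi1, integral_finsetSum _ hi2]
        simp_rw [integral_const_mul]
    _ ≤ (∑ k ∈ Finset.range N, (1 / 2) ^ (k + 1) +
          ∑ k ∈ Finset.range N, (1 / 2) ^ (k + 1) * 1) / 2 := by
        refine div_le_div_of_nonneg_right (add_le_add
          (Finset.sum_le_sum fun k _ => hnext1 k (S k)) (Finset.sum_le_sum fun k _ =>
            mul_le_mul_of_nonneg_left ?_ (by positivity))) zero_le_two
        have := hnext2 k (S k)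
        simpa only [hSsum] using this
    _ ≤ 1 := by
        simp only [mul_one]
        linarith [hgeom N]

end Selection

theorem modular_bound_of_isWeaklyCompactOp {Ω : Type*} [MeasurableSpace Ω] {μ : Measure Ω}
    [IsProbabilityMeasure μ] {Ψ : ℝ → ℝ} (hΨ : IsOrliczFunction Ψ) {X : Submodule ℂ (Ω → ℂ)}
    (hXM : ∀ f ∈ X, MemMorseTransue Ψ μ f)
    {Y : Type*} [NormedAddCommGroup Y] [NormedSpace ℂ Y]
    {T : X →ₗ[ℂ] Y} (hT : ∃ M : ℝ, ∀ f : X, ‖T f‖ ≤ M * luxNorm Ψ μ (f : Ω → ℂ))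
    (hTc : IsWeaklyCompactOp Ψ μ T) {ε : ℝ} (hε : 0 < ε) :
    ∃ C > 0, ∀ f : X, luxNorm Ψ μ (f : Ω → ℂ) ≠ 0 →
        ‖T f‖ ≤ (C * (orliczModular Ψ μ (f : Ω → ℂ)
              (luxNorm Ψ μ (f : Ω → ℂ) / ε)).toReal + ε) * luxNorm Ψ μ (f : Ω → ℂ) := by
  obtain ⟨M, hM, hTM⟩ : ∃ M > 0, ∀ f : X, ‖T f‖ ≤ M * luxNorm Ψ μ (f : Ω → ℂ) := by
    obtain ⟨M, hM⟩ := hT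
    refine ⟨max M 1, by positivity, fun f => (hM f).trans ?_⟩
    exact mul_le_mul_of_nonneg_right (le_max_left _ _) luxNorm_nonneg
  obtain ⟨K, hK, hTK⟩ := hTc
  by_contra! hcon
  have hu : ∀ n : ℕ, ∃ u : X, ∫ ω, Ψ (ε * ‖(u : Ω → ℂ) ω‖) ∂μ ≤ (1 / 2) ^ n ∧ ε < ‖T u‖ := by
    intro n
    obtain ⟨f, hf0, hf⟩ := hcon (M * 2 ^ n) (by positivity)
    have ht : 0 < luxNorm Ψ μ (f : Ω → ℂ) := lt_of_le_of_ne luxNorm_nonneg hf0.symm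
    have hMf := hTM f
    set t := luxNorm Ψ μ (f : Ω → ℂ)
    have hI : (orliczModular Ψ μ (f : Ω → ℂ) (t / ε)).toReal =
        ∫ ω, Ψ (ε / t * ‖(f : Ω → ℂ) ω‖) ∂μ := by
      rw [← inv_div, (hXM f f.2).orliczModular_eq hΨ (by positivity),
        ENNReal.toReal_ofReal (integral_nonneg fun ω => hΨ.nonneg _)]
    rw [hI] at hf
    have hI0 : 0 ≤ ∫ ω, Ψ (ε / t * ‖(f : Ω → ℂ) ω‖) ∂μ := integral_nonneg fun ω => hΨ.nonneg _
    have hnorm : ‖((t⁻¹ : ℝ) : ℂ)‖ = t⁻¹ := by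
      rw [Complex.norm_real, Real.norm_of_nonneg (by positivity)]
    refine ⟨((t⁻¹ : ℝ) : ℂ) • f, ?_, ?_⟩
    · have h1 : ∀ ω, ε * ‖((((t⁻¹ : ℝ) : ℂ) • f : X) : Ω → ℂ) ω‖ = ε / t * ‖(f : Ω → ℂ) ω‖ := by
        intro ω
        rw [Submodule.coe_smul, Pi.smul_apply, norm_smul, hnorm]
        ring
      simp_rw [h1]
      have h2 := lt_of_mul_lt_mul_right (hf.trans_le hMf) ht.le
      have h3 : M * (2 ^ n * ∫ ω, Ψ (ε / t * ‖(f : Ω → ℂ) ω‖) ∂μ) ≤ M * 1 := by linarith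
      have h4 := le_of_mul_le_mul_left h3 hM
      rw [one_div, inv_pow, ← one_div, le_div_iff₀ (by positivity)]
      linarith
    · rw [map_smul, norm_smul, hnorm, inv_mul_eq_div, lt_div_iff₀ ht]
      refine lt_of_le_of_lt ?_ hf
      gcongr
      exact le_add_of_nonneg_left (by positivity)
  choose u hu1 hu2 using hu
  obtain ⟨σ, hσ⟩ := hΨ.exists_subseq_integral_sum_le (u := fun n => (u n : Ω → ℂ))
    (fun n => hXM _ (u n).2) hε hu1
  have hε2 : ‖((ε / 2 : ℝ) : ℂ)‖ = ε / 2 := by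
    rw [Complex.norm_real, Real.norm_of_nonneg (by positivity)]
  have hsum : ∀ c : ℕ → ℂ, (∀ k, ‖c k‖ ≤ 1) → ∀ N, toWeakSpace ℂ Y
      (∑ k ∈ Finset.range N, c k • T (((ε / 2 : ℝ) : ℂ) • u (σ k))) ∈ K := by
    intro c hc N
    set g : X := ∑ k ∈ Finset.range N, c k • ((ε / 2 : ℝ) : ℂ) • u (σ k) with hg
    have hTg : ∑ k ∈ Finset.range N, c k • T (((ε / 2 : ℝ) : ℂ) • u (σ k)) = T g := by
      simp only [hg, map_sum, map_smul]
    rw [hTg]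
    refine hTK ⟨T g, ⟨g, ?_, rfl⟩, rfl⟩
    have hgω : ∀ ω, ‖(g : Ω → ℂ) ω‖ ≤
        ε / 2 * ∑ k ∈ Finset.range N, ‖(u (σ k) : Ω → ℂ) ω‖ := by
      intro ω
      rw [hg, Submodule.coe_sum, Finset.sum_apply, Finset.mul_sum]
      refine norm_sum_le_of_le _ fun k _ => ?_
      rw [Submodule.coe_smul, Submodule.coe_smul, Pi.smul_apply, Pi.smul_apply, norm_smul,
        norm_smul, hε2]
      exact mul_le_of_le_one_left (by positivity) (hc k)
    have h1 : ∫ ω, Ψ (1 * ‖(g : Ω → ℂ) ω‖) ∂μ ≤ 1 := by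
      refine le_trans (integral_mono ((hXM g g.2).integrable hΨ zero_le_one) (hσ N).1
        fun ω => ?_) (hσ N).2
      rw [one_mul]
      exact hΨ.mono (mem_Ici.2 (norm_nonneg _)) (mem_Ici.2 ((norm_nonneg _).trans (hgω ω)))
        (hgω ω)
    exact ((hXM g g.2).luxNorm_le hΨ one_pos h1).trans inv_one.le
  obtain ⟨k, hk⟩ := exists_norm_le_of_forall_sum_mem_isCompact hK hsum
    (show 0 < ε / 2 * ε by positivity)
  rw [map_smul, norm_smul, hε2] at hk
  exact (mul_lt_mul_of_pos_left (hu2 (σ k)) (by positivity)).not_ge hk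

/-- If the complementary function of `Ψ` satisfies `Δ₂`, then an operator `T` on a subspace
`X` of `M^Ψ` is weakly compact iff for every `ε > 0` there is `C_ε > 0` with
`‖Tf‖ ≤ (C_ε ∫ Ψ(ε|f|/‖f‖_Ψ) dP + ε) ‖f‖_Ψ` for every nonzero `f ∈ X`. -/
theorem statement1 {Ω : Type*} [MeasurableSpace Ω] (μ : Measure Ω) [IsProbabilityMeasure μ]
    {Ψ : ℝ → ℝ} (hΨ : IsOrliczFunction Ψ) (hΦ : Delta2 (complementaryOrlicz Ψ))
    (X : Submodule ℂ (Ω → ℂ)) (hXM : ∀ f ∈ X, MemMorseTransue Ψ μ f)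
    (hXclosed : IsLuxClosedIn Ψ μ X)
    {Y : Type*} [NormedAddCommGroup Y] [NormedSpace ℂ Y] [CompleteSpace Y]
    (T : X →ₗ[ℂ] Y) (hT : ∃ M : ℝ, ∀ f : X, ‖T f‖ ≤ M * luxNorm Ψ μ (f : Ω → ℂ)) :
    IsWeaklyCompactOp Ψ μ T ↔
      ∀ ε > 0, ∃ C > 0, ∀ f : X, luxNorm Ψ μ (f : Ω → ℂ) ≠ 0 →
        ‖T f‖ ≤ (C * (orliczModular Ψ μ (f : Ω → ℂ)
              (luxNorm Ψ μ (f : Ω → ℂ) / ε)).toReal + ε) * luxNorm Ψ μ (f : Ω → ℂ) := by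
  exact ⟨fun h _ hε => modular_bound_of_isWeaklyCompactOp hΨ hXM hT h hε,
    isWeaklyCompactOp_of_modular_bound hΨ hΦ hXM hT⟩

end
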